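/- Let k be a positive integer not divisible by the characteristic p of 𝔽_q, and let X^k − 1 = φ_1·φ_2⋯φ_r be the factorization of X^k − 1 over 𝔽_q into pairwise distinct monic irreducible polynomials, with d_i = deg φ_i. Let a_n be the number of n×n matrices A over 𝔽_q with A^k = I, and a_0 = 1. Then in the ring of formal power series ℚ⟦u⟧: Σ_{n≥0} (a_n/γ_n(q)) u^n = ∏_{i=1}^{r} ( Σ_{m≥0} u^{m·d_i} / γ_m(q^{d_i}) ), where for any prime power Q, γ_m(Q) = ∏_{j=0}^{m−1} (Q^m − Q^j) and γ_0(Q) = 1. -/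

import Mathlib

/-- `gam Q m` is the order of `GL_m(F_Q)`: `∏_{j=0}^{m-1} (Q^m - Q^j)`. -/
def gam (Q m : ℕ) : ℕ := ∏ j ∈ Finset.range m, (Q ^ m - Q ^ j)

open Polynomial Module

lemma gam_pos {Q : ℕ} (hQ : 1 < Q) (m : ℕ) : 0 < gam Q m :=
  Finset.prod_pos fun _ hj => Nat.sub_pos_of_lt (Nat.pow_lt_pow_right hQ (Finset.mem_range.mp hj))

lemma card_linearEquiv {K V W : Type*} [Field K] [Fintype K] [AddCommGroup V] [Module K V]
    [Module.Finite K V] [AddCommGroup W] [Module K W] [Module.Finite K W] :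
    Nat.card (V ≃ₗ[K] W) =
      if finrank K V = finrank K W then gam (Fintype.card K) (finrank K V) else 0 := by
  split_ifs with h
  · let e : V ≃ₗ[K] (Fin (finrank K V) → K) := LinearEquiv.ofFinrankEq _ _ (by simp)
    let e' : W ≃ₗ[K] (Fin (finrank K V) → K) := LinearEquiv.ofFinrankEq _ _ (by simp [h])
    let E : (V ≃ₗ[K] W) ≃ ((Fin (finrank K V) → K) ≃ₗ[K] (Fin (finrank K V) → K)) :=
      { toFun := fun u => e.symm ≪≫ₗ u ≪≫ₗ e'
        invFun := fun u => e ≪≫ₗ u ≪≫ₗ e'.symm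
        left_inv := fun u => by ext; simp
        right_inv := fun u => by ext1; simp }
    rw [Nat.card_congr E, Nat.card_congr
      (Matrix.GeneralLinearGroup.toLin.trans
        (LinearMap.GeneralLinearGroup.generalLinearEquiv K _)).symm.toEquiv,
      Matrix.card_GL_field, gam, Finset.prod_range]
  · have : IsEmpty (V ≃ₗ[K] W) := ⟨fun e => h e.finrank_eq⟩
    simp

lemma aeval_apply_of_intertwine {R V W : Type*} [CommRing R] [AddCommGroup V] [Module R V]
    [AddCommGroup W] [Module R W] {A : End R V} {B : End R W} (T : V →ₗ[R] W)
    (h : ∀ v, B (T v) = T (A v)) (f : R[X]) (v : V) : aeval B f (T v) = T (aeval A f v) := by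
  induction f using Polynomial.induction_on' generalizing v with
  | add p q hp hq => simp [hp, hq]
  | monomial n a =>
    have : (B ^ n) (T v) = T ((A ^ n) v) := by
      induction n generalizing v with
      | zero => simp
      | succ n ih => simp [pow_succ, h, ih]
    simp [aeval_monomial, this]

section Coprime

variable {F V V₁ V₂ : Type*} [Field F] [AddCommGroup V] [Module F V] [AddCommGroup V₁]
  [Module F V₁] [AddCommGroup V₂] [Module F V₂]

lemma isCompl_ker_aeval {f g : F[X]} (hfg : IsCoprime f g) {A : End F V}
    (hA : aeval A (f * g) = 0) : IsCompl (aeval A f).ker (aeval A g).ker :=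
  ⟨disjoint_ker_aeval_of_isCoprime A hfg, codisjoint_iff.mpr <| by
    rw [sup_ker_aeval_eq_ker_aeval_mul_of_coprime A hfg, hA, LinearMap.ker_zero]⟩

lemma apply_mem_ker_aeval (A : End F V) (f : F[X]) {v : V} (hv : v ∈ (aeval A f).ker) :
    A v ∈ (aeval A f).ker := by
  rw [LinearMap.mem_ker] at *
  rw [aeval_apply_of_intertwine (A := A) A (fun _ => rfl), hv, map_zero]

/-- The operator on `V₁` obtained by transporting the restriction of `A` to `ker (f A)`. -/
noncomputable def kerConj (A : End F V) (f : F[X]) (e : V₁ ≃ₗ[F] (aeval A f).ker) : End F V₁ :=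
  e.symm.conj (A.restrict fun _ => apply_mem_ker_aeval A f)

lemma coe_kerConj_apply (A : End F V) (f : F[X]) (e : V₁ ≃ₗ[F] (aeval A f).ker) (x : V₁) :
    (e (kerConj A f e x) : V) = A (e x) := by
  simp [kerConj, LinearEquiv.conj_apply]

lemma aeval_kerConj (A : End F V) (f : F[X]) (e : V₁ ≃ₗ[F] (aeval A f).ker) :
    aeval (kerConj A f e) f = 0 := by
  ext x
  have := aeval_apply_of_intertwine (A := kerConj A f e) (B := A)
    ((aeval A f).ker.subtype ∘ₗ e.toLinearMap) (fun v => by simp [coe_kerConj_apply]) f x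
  simpa using this.symm

/-- Decompose an operator killed by `f * g` along the kernels of its values at `f` and `g`. -/
noncomputable def splitOperator (f g : F[X]) (hfg : IsCoprime f g)
    (t : Σ A : {A : End F V // aeval A (f * g) = 0},
      (V₁ ≃ₗ[F] (aeval A.1 f).ker) × (V₂ ≃ₗ[F] (aeval A.1 g).ker)) :
    {B : End F V₁ // aeval B f = 0} × {C : End F V₂ // aeval C g = 0} × ((V₁ × V₂) ≃ₗ[F] V) :=
  ⟨⟨kerConj t.1.1 f t.2.1, aeval_kerConj ..⟩, ⟨kerConj t.1.1 g t.2.2, aeval_kerConj ..⟩,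
    (t.2.1.prodCongr t.2.2) ≪≫ₗ Submodule.prodEquivOfIsCompl _ _ (isCompl_ker_aeval hfg t.1.2)⟩

lemma splitOperator_injective (f g : F[X]) (hfg : IsCoprime f g) :
    Function.Injective (splitOperator (V := V) (V₁ := V₁) (V₂ := V₂) f g hfg) := by
  rintro ⟨⟨A, hA⟩, e₁, e₂⟩ ⟨⟨A', hA'⟩, e₁', e₂'⟩ h
  simp only [splitOperator, Prod.mk.injEq, Subtype.mk.injEq] at h
  obtain ⟨hB, hC, he⟩ := h
  have he' (x : V₁) (y : V₂) : (e₁ x + e₂ y : V) = e₁' x + e₂' y := by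
    simpa using LinearEquiv.congr_fun he (x, y)
  have h₁ (x : V₁) : (e₁ x : V) = e₁' x := by simpa using he' x 0
  have h₂ (y : V₂) : (e₂ y : V) = e₂' y := by simpa using he' 0 y
  have hAA' : A = A' := by
    ext v
    obtain ⟨⟨x, y⟩, rfl⟩ := ((e₁.prodCongr e₂) ≪≫ₗ
      Submodule.prodEquivOfIsCompl _ _ (isCompl_ker_aeval hfg hA)).surjective v
    have hx : A (e₁ x) = A' (e₁ x) := by
      rw [← coe_kerConj_apply, hB, h₁, h₁, coe_kerConj_apply]
    have hy : A (e₂ y) = A' (e₂ y) := by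
      rw [← coe_kerConj_apply, hC, h₂, h₂, coe_kerConj_apply]
    simp [hx, hy]
  subst hAA'
  have : e₁ = e₁' := by ext x; exact h₁ x
  have : e₂ = e₂' := by ext x; exact h₂ x
  simp_all

lemma exists_linearEquiv_ker_aeval {f g : F[X]} (hfg : IsCoprime f g) {A : End F V}
    {B : End F V₁} {C : End F V₂} (hB : aeval B f = 0) (hC : aeval C g = 0)
    (e : (V₁ × V₂) ≃ₗ[F] V) (h₁ : ∀ x, A (e (x, 0)) = e (B x, 0))
    (h₂ : ∀ y, A (e (0, y)) = e (0, C y)) :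
    ∃ e₁ : V₁ ≃ₗ[F] (aeval A f).ker, ∀ x, (e₁ x : V) = e (x, 0) := by
  have k₁ (p : F[X]) (x : V₁) : aeval A p (e (x, 0)) = e (aeval B p x, 0) :=
    aeval_apply_of_intertwine (A := B) (B := A) (e.toLinearMap ∘ₗ LinearMap.inl F V₁ V₂)
      (by simpa using h₁) p x
  have k₂ (p : F[X]) (y : V₂) : aeval A p (e (0, y)) = e (0, aeval C p y) :=
    aeval_apply_of_intertwine (A := C) (B := A) (e.toLinearMap ∘ₗ LinearMap.inr F V₁ V₂)
      (by simpa using h₂) p y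
  refine ⟨LinearEquiv.ofBijective ((e.toLinearMap ∘ₗ LinearMap.inl F V₁ V₂).codRestrict _
    fun x => ?_) ⟨?_, ?_⟩, fun x => rfl⟩
  · simp [k₁, hB]
  · intro x y hxy
    have := e.injective (congrArg Subtype.val hxy :)
    exact congrArg Prod.fst this
  · rintro ⟨v, hv⟩
    obtain ⟨⟨x, y⟩, rfl⟩ := e.surjective v
    have hxy : (x, y) = (x, 0) + (0, y) := by simp
    have hy : aeval C f y = 0 := by
      rw [LinearMap.mem_ker, hxy, map_add, map_add, k₁, k₂, hB,
        LinearMap.zero_apply, ← map_add, map_eq_zero_iff e e.injective] at hv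
      simpa using hv
    have hy0 : y = 0 := by
      have := (disjoint_ker_aeval_of_isCoprime C hfg).le_bot
        (show y ∈ (aeval C f).ker ⊓ (aeval C g).ker by simp [hy, hC])
      simpa using this
    subst hy0
    exact ⟨x, rfl⟩

lemma splitOperator_surjective (f g : F[X]) (hfg : IsCoprime f g) :
    Function.Surjective (splitOperator (V := V) (V₁ := V₁) (V₂ := V₂) f g hfg) := by
  rintro ⟨⟨B, hB⟩, ⟨C, hC⟩, e⟩
  let A : End F V := e.conj (B.prodMap C)
  have h₁ (x) : A (e (x, 0)) = e (B x, 0) := by simp [A, LinearEquiv.conj_apply]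
  have h₂ (y) : A (e (0, y)) = e (0, C y) := by simp [A, LinearEquiv.conj_apply]
  obtain ⟨e₁, he₁⟩ := exists_linearEquiv_ker_aeval hfg hB hC e h₁ h₂
  obtain ⟨e₂, he₂⟩ := exists_linearEquiv_ker_aeval hfg.symm (A := A) hC hB
    (LinearEquiv.prodComm F V₂ V₁ ≪≫ₗ e) (by simpa using h₂) (by simpa using h₁)
  replace he₂ (y) : (e₂ y : V) = e (0, y) := he₂ y
  have hA : aeval A (f * g) = 0 := by
    ext v
    obtain ⟨⟨x, y⟩, rfl⟩ := e.surjective v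
    have hxy : (x, y) = (x, 0) + (0, y) := by simp
    have hx := LinearMap.mem_ker.mp (e₁ x).2
    have hy := LinearMap.mem_ker.mp (e₂ y).2
    rw [hxy, map_add, ← he₁, ← he₂, map_add, aeval_mul,
      Module.End.mul_apply (aeval A f) _ (e₂ y : V), hy, ← aeval_mul, mul_comm, aeval_mul,
      Module.End.mul_apply, hx]
    simp
  refine ⟨⟨⟨A, hA⟩, e₁, e₂⟩, ?_⟩
  simp only [splitOperator, Prod.mk.injEq, Subtype.mk.injEq]
  refine ⟨?_, ?_, ?_⟩
  · ext x
    apply e₁.injective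
    ext
    rw [coe_kerConj_apply, he₁, he₁, h₁]
  · ext x
    apply e₂.injective
    ext
    rw [coe_kerConj_apply, he₂, he₂, h₂]
  · ext ⟨x, y⟩
    simp [he₁, he₂, ← map_add]

lemma card_mul_card_mul_card_linearEquiv [Finite F] [Module.Finite F V]
    [Module.Finite F V₁] [Module.Finite F V₂] (f g : F[X]) (hfg : IsCoprime f g)
    [Fintype {A : End F V // aeval A (f * g) = 0}] :
    Nat.card {B : End F V₁ // aeval B f = 0} * (Nat.card {C : End F V₂ // aeval C g = 0} *
      Nat.card ((V₁ × V₂) ≃ₗ[F] V)) = ∑ A : {A : End F V // aeval A (f * g) = 0},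
        Nat.card (V₁ ≃ₗ[F] (aeval A.1 f).ker) * Nat.card (V₂ ≃ₗ[F] (aeval A.1 g).ker) := by
  have := Module.finite_of_finite F (M := V)
  have := Module.finite_of_finite F (M := V₁)
  have := Module.finite_of_finite F (M := V₂)
  have h₁ (W : Submodule F V) : Finite (V₁ ≃ₗ[F] W) := DFunLike.finite _
  have h₂ (W : Submodule F V) : Finite (V₂ ≃ₗ[F] W) := DFunLike.finite _
  rw [← Nat.card_prod, ← Nat.card_prod, ← Nat.card_eq_of_bijective _
    ⟨splitOperator_injective f g hfg, splitOperator_surjective f g hfg⟩, Nat.card_sigma]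
  simp only [Nat.card_prod]

end Coprime

section Irreducible

lemma map_smul_of_adjoin_eq_top {F K V W : Type*} [Field F] [Field K] [Algebra F K]
    [AddCommGroup V] [Module F V] [Module K V] [IsScalarTower F K V] [AddCommGroup W]
    [Module F W] [Module K W] [IsScalarTower F K W] {x : K} (hx : Algebra.adjoin F {x} = ⊤)
    (e : V →ₗ[F] W) (he : ∀ v, e (x • v) = x • e v) (c : K) (v : V) : e (c • v) = c • e v := by
  have hc : c ∈ Algebra.adjoin F {x} := hx ▸ Algebra.mem_top
  induction hc using Algebra.adjoin_induction generalizing v with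
  | mem y hy => rw [Set.mem_singleton_iff.mp hy, he]
  | algebraMap r => simp
  | add a b _ _ ha hb => simp [add_smul, ha, hb]
  | mul a b _ _ ha hb => simp [mul_smul, ha, hb]

/-- Over a generated extension, linear equivalences are those commuting with the generator. -/
noncomputable def linearEquivOfAdjoinEqTop {F K : Type*} (V W : Type*) [Field F] [Field K]
    [Algebra F K] [AddCommGroup V] [Module F V] [Module K V] [IsScalarTower F K V]
    [AddCommGroup W] [Module F W] [Module K W] [IsScalarTower F K W] {x : K}
    (hx : Algebra.adjoin F {x} = ⊤) :
    {e : V ≃ₗ[F] W // ∀ v, e (x • v) = x • e v} ≃ (V ≃ₗ[K] W) where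
  toFun e := { e.1 with map_smul' := map_smul_of_adjoin_eq_top hx e.1.toLinearMap e.2 }
  invFun e := ⟨e.restrictScalars F, fun v => e.map_smul x v⟩
  left_inv _ := rfl
  right_inv _ := rfl

variable {F V : Type*} [Field F] [AddCommGroup V] [Module F V] {φ : F[X]}

/-- The `F[X]/(φ)`-module structure defined by an operator annihilated by `φ`. -/
noncomputable abbrev adjoinRootModule {A : End F V} (hA : aeval A φ = 0) :
    Module (AdjoinRoot φ) V :=
  Module.compHom V (Ideal.Quotient.lift (Ideal.span {φ}) (aeval A : F[X] →ₐ[F] End F V).toRingHom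
    (fun a ha => by
      obtain ⟨b, rfl⟩ := Ideal.mem_span_singleton'.mp ha
      simp [hA]) : AdjoinRoot φ →+* End F V)

lemma adjoinRootModule_mk_smul {A : End F V} (hA : aeval A φ = 0) (f : F[X]) (v : V) :
    letI := adjoinRootModule hA
    AdjoinRoot.mk φ f • v = aeval A f v := rfl

lemma adjoinRootModule_isScalarTower {A : End F V} (hA : aeval A φ = 0) :
    letI := adjoinRootModule hA
    IsScalarTower F (AdjoinRoot φ) V := by
  let := adjoinRootModule hA
  refine ⟨fun c y v => ?_⟩
  obtain ⟨f, rfl⟩ := AdjoinRoot.mk_surjective y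
  rw [AdjoinRoot.smul_mk, adjoinRootModule_mk_smul, adjoinRootModule_mk_smul]
  simp

lemma adjoinRootModule_root_smul {A : End F V} (hA : aeval A φ = 0) (v : V) :
    letI := adjoinRootModule hA
    AdjoinRoot.root φ • v = A v := by
  let := adjoinRootModule hA
  rw [AdjoinRoot.root, adjoinRootModule_mk_smul, aeval_X]

lemma natDegree_dvd_finrank [FiniteDimensional F V] (hφ : Irreducible φ) {A : End F V}
    (hA : aeval A φ = 0) : φ.natDegree ∣ finrank F V := by
  have := Fact.mk hφ
  let := adjoinRootModule hA
  have := adjoinRootModule_isScalarTower hA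
  rw [← Module.finrank_mul_finrank F (AdjoinRoot φ) V,
    (AdjoinRoot.powerBasis hφ.ne_zero).finrank, AdjoinRoot.powerBasis_dim]
  exact dvd_mul_right _ _

/-- Multiplication by the root, transported along a linear equivalence, is annihilated by `φ`. -/
lemma aeval_conj_root {W : Type*} [AddCommGroup W] [Module F W] [Module (AdjoinRoot φ) W]
    [IsScalarTower F (AdjoinRoot φ) W] (e : W ≃ₗ[F] V) :
    aeval (e.conj (Algebra.lsmul F F W (AdjoinRoot.root φ))) φ = 0 := by
  ext v
  obtain ⟨w, rfl⟩ := e.surjective v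
  have := aeval_apply_of_intertwine (A := Algebra.lsmul F F W (AdjoinRoot.root φ))
    (B := e.conj (Algebra.lsmul F F W (AdjoinRoot.root φ))) e.toLinearMap
    (fun v => by simp [LinearEquiv.conj_apply]) φ w
  rw [aeval_algHom_apply (Algebra.lsmul F F W), AdjoinRoot.aeval_eq, AdjoinRoot.mk_self] at this
  simpa using this

lemma card_annihilated_mul_gam [Fintype F] [FiniteDimensional F V] (hφ : Irreducible φ) {m : ℕ}
    (hm : finrank F V = φ.natDegree * m) :
    Nat.card {A : End F V // aeval A φ = 0} * gam (Fintype.card F ^ φ.natDegree) m =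
      gam (Fintype.card F) (finrank F V) := by
  have := Fact.mk hφ
  have hK : finrank F (AdjoinRoot φ) = φ.natDegree := by
    rw [(AdjoinRoot.powerBasis hφ.ne_zero).finrank, AdjoinRoot.powerBasis_dim]
  have : FiniteDimensional F (AdjoinRoot φ) := (AdjoinRoot.powerBasis hφ.ne_zero).finite
  have : Finite (AdjoinRoot φ) := Module.finite_of_finite F
  have : Fintype (AdjoinRoot φ) := Fintype.ofFinite _
  have : Finite V := Module.finite_of_finite F
  have : Finite (End F V) := Module.finite_of_finite F
  have := Fintype.ofFinite {A : End F V // aeval A φ = 0}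
  let W := Fin m → AdjoinRoot φ
  have hW : finrank F W = finrank F V := by
    rw [hm, ← Module.finrank_mul_finrank F (AdjoinRoot φ) W, hK, finrank_fin_fun]
  have : Finite (W ≃ₗ[F] V) := DFunLike.finite _
  let S (A : End F V) := {e : W ≃ₗ[F] V // ∀ w, e (AdjoinRoot.root φ • w) = A (e w)}
  have hS (A : {A : End F V // aeval A φ = 0}) :
      Nat.card (S A.1) = gam (Fintype.card F ^ φ.natDegree) m := by
    let := adjoinRootModule A.2
    have := adjoinRootModule_isScalarTower A.2
    have : Module.Finite (AdjoinRoot φ) V := Module.Finite.of_restrictScalars_finite F _ _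
    have hV : finrank (AdjoinRoot φ) V = m := by
      refine Nat.eq_of_mul_eq_mul_left hφ.natDegree_pos ?_
      rw [← hm, ← hK, Module.finrank_mul_finrank]
    have E := linearEquivOfAdjoinEqTop W V (AdjoinRoot.adjoinRoot_eq_top (f := φ))
    simp only [adjoinRootModule_root_smul] at E
    rw [Nat.card_congr E, card_linearEquiv, hV, finrank_fin_fun, if_pos rfl,
      Module.card_eq_pow_finrank (K := F), hK]
  have hbij : Function.Bijective
      (fun t : Σ A : {A : End F V // aeval A φ = 0}, S A.1 => t.2.1) := by
    constructor
    · rintro ⟨⟨A, hA⟩, ⟨e, he⟩⟩ ⟨⟨A', hA'⟩, ⟨e', he'⟩⟩ h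
      obtain rfl : e = e' := h
      obtain rfl : A = A' := by
        ext v
        obtain ⟨w, rfl⟩ := e.surjective v
        rw [← he, ← he']
      rfl
    · intro e
      exact ⟨⟨⟨_, aeval_conj_root e⟩, e, fun w => by simp [LinearEquiv.conj_apply]⟩, rfl⟩
  have h := Nat.card_eq_of_bijective _ hbij
  rw [Nat.card_sigma, card_linearEquiv, if_pos hW, hW] at h
  simpa [hS, Nat.card_eq_fintype_card] using h

end Irreducible

variable {F : Type*} [Field F] [Fintype F]

/-- The number of operators on `Fⁿ` annihilated by `f`. -/
noncomputable def annihilatedCount (f : F[X]) (n : ℕ) : ℕ :=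
  Nat.card {A : End F (Fin n → F) // aeval A f = 0}

/-- The generating function of `annihilatedCount f`, normalized by the orders of the general
linear groups. -/
noncomputable def annihilatedGenFun (f : F[X]) : PowerSeries ℚ :=
  PowerSeries.mk fun n => (annihilatedCount f n : ℚ) / gam (Fintype.card F) n

lemma annihilatedGenFun_mul {f g : F[X]} (hfg : IsCoprime f g) :
    annihilatedGenFun (f * g) = annihilatedGenFun f * annihilatedGenFun g := by
  classical
  have hγ (n : ℕ) : (gam (Fintype.card F) n : ℚ) ≠ 0 :=
    Nat.cast_ne_zero.mpr (gam_pos Fintype.one_lt_card n).ne'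
  ext n
  have hfin : Finite {A : End F (Fin n → F) // aeval A (f * g) = 0} := by
    have := Module.finite_of_finite F (M := End F (Fin n → F))
    infer_instance
  have := Fintype.ofFinite {A : End F (Fin n → F) // aeval A (f * g) = 0}
  have key (p : ℕ × ℕ) (hp : p ∈ Finset.HasAntidiagonal.antidiagonal n) :
      (annihilatedCount f p.1 : ℚ) / gam (Fintype.card F) p.1 *
        (annihilatedCount g p.2 / gam (Fintype.card F) p.2) =
      (∑ A : {A : End F (Fin n → F) // aeval A (f * g) = 0},
        if (finrank F (aeval A.1 f).ker, finrank F (aeval A.1 g).ker) = p then (1 : ℚ) else 0)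
        / gam (Fintype.card F) n := by
    obtain ⟨i, j⟩ := p
    have hij : i + j = n := by simpa using hp
    have h := card_mul_card_mul_card_linearEquiv (V := Fin n → F) (V₁ := Fin i → F)
      (V₂ := Fin j → F) f g hfg
    simp only [card_linearEquiv, finrank_prod, finrank_fin_fun, hij, if_true] at h
    have h' := congrArg (Nat.cast : ℕ → ℚ) h
    push_cast at h'
    have hs : (∑ A : {A : End F (Fin n → F) // aeval A (f * g) = 0},
        (if i = finrank F (aeval A.1 f).ker then (gam (Fintype.card F) i : ℚ) else 0) *
        (if j = finrank F (aeval A.1 g).ker then (gam (Fintype.card F) j : ℚ) else 0)) =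
        (∑ A : {A : End F (Fin n → F) // aeval A (f * g) = 0},
        if (finrank F (aeval A.1 f).ker, finrank F (aeval A.1 g).ker) = (i, j)
          then (1 : ℚ) else 0) * (gam (Fintype.card F) i * gam (Fintype.card F) j) := by
      rw [Finset.sum_mul]
      refine Finset.sum_congr rfl fun A _ => ?_
      grind
    rw [hs] at h'
    simp only [annihilatedCount]
    rw [div_mul_div_comm, div_eq_div_iff (mul_ne_zero (hγ _) (hγ _)) (hγ _), ← h', mul_assoc]
  rw [PowerSeries.coeff_mul]
  simp only [annihilatedGenFun, PowerSeries.coeff_mk]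
  rw [Finset.sum_congr rfl key, ← Finset.sum_div, Finset.sum_comm]
  congr 1
  have h1 (A : {A : End F (Fin n → F) // aeval A (f * g) = 0}) :
      (finrank F (aeval A.1 f).ker, finrank F (aeval A.1 g).ker) ∈
        Finset.HasAntidiagonal.antidiagonal n := by
    rw [Finset.HasAntidiagonal.mem_antidiagonal]
    simpa using Submodule.finrank_add_eq_of_isCompl (isCompl_ker_aeval hfg A.2)
  simp only [Finset.sum_ite_eq, h1, if_true]
  rw [annihilatedCount, Nat.card_eq_fintype_card]
  simp

lemma annihilatedGenFun_one : annihilatedGenFun (1 : F[X]) = 1 := by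
  ext n
  rw [annihilatedGenFun, PowerSeries.coeff_mk, PowerSeries.coeff_one, annihilatedCount]
  split_ifs with h
  · subst h
    have : Unique {A : End F (Fin 0 → F) // aeval A (1 : F[X]) = 0} :=
      ⟨⟨0, Subsingleton.elim _ _⟩, fun _ => Subsingleton.elim _ _⟩
    rw [Nat.card_unique]
    simp [gam]
  · have : NeZero n := ⟨h⟩
    have : IsEmpty {A : End F (Fin n → F) // aeval A (1 : F[X]) = 0} :=
      ⟨fun A => one_ne_zero ((map_one (aeval A.1)).symm.trans A.2)⟩
    simp

lemma annihilatedGenFun_prod {ι : Type*} (s : Finset ι) (φ : ι → F[X])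
    (h : (s : Set ι).Pairwise fun i j => IsCoprime (φ i) (φ j)) :
    annihilatedGenFun (∏ i ∈ s, φ i) = ∏ i ∈ s, annihilatedGenFun (φ i) := by
  classical
  induction s using Finset.induction_on with
  | empty => simp [annihilatedGenFun_one]
  | insert i s hi ih =>
    rw [Finset.prod_insert hi, Finset.prod_insert hi, annihilatedGenFun_mul, ih]
    · exact h.mono (by simp)
    · exact IsCoprime.prod_right fun j hj =>
        h (by simp) (by simp [hj]) (by rintro rfl; exact hi hj)

lemma annihilatedGenFun_of_irreducible {φ : F[X]} (hφ : Irreducible φ) :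
    annihilatedGenFun φ = PowerSeries.mk fun n => if φ.natDegree ∣ n then
      (1 : ℚ) / gam (Fintype.card F ^ φ.natDegree) (n / φ.natDegree) else 0 := by
  ext n
  rw [annihilatedGenFun, PowerSeries.coeff_mk, PowerSeries.coeff_mk, annihilatedCount]
  split_ifs with h
  · obtain ⟨m, rfl⟩ := h
    have hc := card_annihilated_mul_gam (V := Fin (φ.natDegree * m) → F) hφ (m := m) (by simp)
    rw [finrank_fin_fun] at hc
    rw [Nat.mul_div_cancel_left _ hφ.natDegree_pos, div_eq_div_iff
      (Nat.cast_ne_zero.mpr (gam_pos Fintype.one_lt_card _).ne')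
      (Nat.cast_ne_zero.mpr
        (gam_pos (Nat.one_lt_pow hφ.natDegree_pos.ne' Fintype.one_lt_card) _).ne'), one_mul]
    exact_mod_cast hc
  · have : IsEmpty {A : End F (Fin n → F) // aeval A φ = 0} :=
      ⟨fun A => h (by simpa using natDegree_dvd_finrank hφ A.2)⟩
    simp

lemma card_matrix_pow_eq_one {F : Type*} [Field F] (k n : ℕ) :
    Nat.card {A : Matrix (Fin n) (Fin n) F // A ^ k = 1} =
      annihilatedCount (X ^ k - 1 : F[X]) n :=
  Nat.card_congr <| Matrix.toLinAlgEquiv'.toEquiv.subtypeEquiv fun A => by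
    simp only [map_sub, map_pow, aeval_X, map_one, sub_eq_zero]
    exact (by rw [← map_pow, map_eq_one_iff _ Matrix.toLinAlgEquiv'.injective] :
      A ^ k = 1 ↔ Matrix.toLinAlgEquiv' A ^ k = 1)

theorem kthRootsOfUnityCount_genFun {F : Type} [Field F] [Fintype F] (q p : ℕ)
    (hq : Fintype.card F = q) (hp : p = ringChar F)
    (k : ℕ) (hk : 0 < k) (hpk : ¬ p ∣ k)
    (r : ℕ) (φ : Fin r → Polynomial F)
    (hmonic : ∀ i, (φ i).Monic) (hirr : ∀ i, Irreducible (φ i))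
    (hdist : Function.Injective φ)
    (hfact : ∏ i, φ i = Polynomial.X ^ k - 1)
    (d : Fin r → ℕ) (hd : ∀ i, d i = (φ i).natDegree)
    (a : ℕ → ℕ)
    (ha : ∀ n, a n = Nat.card {A : Matrix (Fin n) (Fin n) F // A ^ k = 1}) :
    PowerSeries.mk (fun n => (a n : ℚ) / (gam q n : ℚ))
      = ∏ i : Fin r, PowerSeries.mk
          (fun n => if d i ∣ n then (1 : ℚ) / (gam (q ^ d i) (n / d i) : ℚ) else 0) := by
  
  subst hq
  have hcop : ((Finset.univ : Finset (Fin r)) : Set (Fin r)).Pairwise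
      fun i j => IsCoprime (φ i) (φ j) := fun i _ j _ hij =>
    ((hirr i).coprime_iff_not_dvd).mpr fun h => hij <| hdist <|
      eq_of_monic_of_associated (hmonic i) (hmonic j) ((hirr i).associated_of_dvd (hirr j) h)
  have h := annihilatedGenFun_prod Finset.univ φ hcop
  rw [hfact] at h
  simp only [annihilatedGenFun_of_irreducible (hirr _), ← hd] at h
  rw [← h, annihilatedGenFun]
  simp only [ha, card_matrix_pow_eq_one]
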